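/- Let q be the parabolic contraction of a simple Lie algebra g associated with a Cartan subalgebra h, a base π of its root system R, and a proper subset π' ⊊ π, with highest root θ. A nonzero element e ∈ q of degree 1 in Sym(q) is a semi-invariant if and only if e ∈ g_β for some β ∈ (−π \ −π') ∪ {θ} such that in the extended Dynkin diagram of R, the node corresponding to −β is not adjacent to any node corresponding to an element of π'. -/

import Mathlib

/-- The root space `g_β = {e : ∀ h ∈ H, [h,e] = β(h) • e}` attached to a subspace `H`
and a linear functional `β` on `H`. -/
def rootSp {K g : Type*} [Field K] [LieRing g] [LieAlgebra K g]
    (H : Submodule K g) (β : Module.Dual K H) : Submodule K g where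
  carrier := {e | ∀ y : H, ⁅(y : g), e⁆ = β y • e}
  add_mem' := by
    intro a b ha hb y
    rw [lie_add, ha y, hb y, smul_add]
  zero_mem' := by
    intro y
    simp
  smul_mem' := by
    intro c a ha y
    rw [lie_smul, ha y, smul_comm]

/-- `α` is a linear combination with natural-number coefficients of elements of `S`. -/
def isNNComb {K g : Type*} [Field K] [LieRing g] [LieAlgebra K g]
    (H : Submodule K g) (S : Set (Module.Dual K H)) (α : Module.Dual K H) : Prop :=
  ∃ c : Module.Dual K H →₀ ℕ, ↑c.support ⊆ S ∧ α = c.sum fun γ k => k • γ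


namespace PC

set_option linter.unusedSectionVars false

open LieAlgebra LieAlgebra.IsKilling LieModule Module

section comb

variable {K V : Type*} [Field K] [CharZero K] [AddCommGroup V] [Module K V]

lemma nn_nat {S : Set V} (f : V →ₗ[K] K) (hf : ∀ a ∈ S, ∃ n : ℕ, f a = n) {x : V}
    (hx : x ∈ Submodule.span ℕ S) : ∃ n : ℕ, f x = n := by
  induction hx using Submodule.span_induction with
  | mem x h => exact hf x h
  | zero => exact ⟨0, by simp⟩
  | add x y _ _ hx hy =>
    obtain ⟨n, hn⟩ := hx
    obtain ⟨m, hm⟩ := hy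
    exact ⟨n + m, by simp [hn, hm]⟩
  | smul k x _ hx =>
    obtain ⟨n, hn⟩ := hx
    exact ⟨k * n, by simp [hn]⟩

lemma nn_eq_zero {S : Set V} (f : V →ₗ[K] K) (hf : ∀ a ∈ S, f a = 0) {x : V}
    (hx : x ∈ Submodule.span ℕ S) : f x = 0 := by
  induction hx using Submodule.span_induction with
  | mem x h => exact hf x h
  | zero => simp
  | add x y _ _ hx hy => simp [hx, hy]
  | smul k x _ hx => simp [hx]

lemma exists_coord {π : Set V} (h : LinearIndependent K fun a : π => (a : V)) :
    ∃ φ : V → (V →ₗ[K] K), ∀ a ∈ π, φ a a = 1 ∧ ∀ b ∈ π, b ≠ a → φ a b = 0 := by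
  classical
  have h' : LinearIndepOn K id π := h
  let B := Basis.extend h'
  have hsub := h'.subset_extend (Set.subset_univ π)
  refine ⟨fun a => if ha : a ∈ π then B.coord ⟨a, hsub ha⟩ else 0, ?_⟩
  intro a ha
  have key : ∀ b (hb : b ∈ π), B ⟨b, hsub hb⟩ = b := fun b hb =>
    Basis.extend_apply_self h' ⟨b, hsub hb⟩
  simp only [ha, dif_pos]
  have key2 : ∀ b (hb : b ∈ π), B.coord ⟨a, hsub ha⟩ b = if b = a then 1 else 0 := by
    intro b hb
    have : B.coord ⟨a, hsub ha⟩ (B ⟨b, hsub hb⟩) = if b = a then 1 else 0 := by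
      rw [Basis.coord_apply, Basis.repr_self, Finsupp.single_apply]
      simp
    rwa [key b hb] at this
  refine ⟨?_, ?_⟩
  · simp [key2 a ha]
  · intro b hb hba
    simp [key2 b hb, hba]

variable {π : Set V} {φ : V → (V →ₗ[K] K)}

lemma coord_nat (hφ : ∀ a ∈ π, φ a a = 1 ∧ ∀ b ∈ π, b ≠ a → φ a b = 0)
    {a x : V} (ha : a ∈ π) (hx : x ∈ Submodule.span ℕ π) :
    ∃ n : ℕ, φ a x = n := by
  refine nn_nat (φ a) (fun b hb => ?_) hx
  by_cases h : b = a
  · exact ⟨1, by simp [h, (hφ a ha).1]⟩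
  · exact ⟨0, by simp [(hφ a ha).2 b hb h]⟩

lemma coord_zero (hφ : ∀ a ∈ π, φ a a = 1 ∧ ∀ b ∈ π, b ≠ a → φ a b = 0)
    {S : Set V} (hS : S ⊆ π) {a x : V} (ha : a ∈ π) (haS : a ∉ S)
    (hx : x ∈ Submodule.span ℕ S) : φ a x = 0 :=
  nn_eq_zero (φ a) (fun b hb => (hφ a ha).2 b (hS hb) (by rintro rfl; exact haS hb)) hx

lemma mem_of_coord (hφ : ∀ a ∈ π, φ a a = 1 ∧ ∀ b ∈ π, b ≠ a → φ a b = 0)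
    {S : Set V} {x : V} (hx : x ∈ Submodule.span ℕ π)
    (h : ∀ a ∈ π, a ∉ S → φ a x = 0) : x ∈ Submodule.span ℕ S := by
  induction hx using Submodule.span_induction with
  | mem x hx =>
    by_cases hxS : x ∈ S
    · exact Submodule.subset_span hxS
    · have := h x hx hxS
      simp [(hφ x hx).1] at this
  | zero => simp
  | add x y hx hy ihx ihy =>
    refine Submodule.add_mem _ (ihx fun a ha haS => ?_) (ihy fun a ha haS => ?_) <;>
    · obtain ⟨n, hn⟩ := coord_nat hφ ha hx
      obtain ⟨m, hm⟩ := coord_nat hφ ha hy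
      have := h a ha haS
      rw [map_add, hn, hm] at this
      have : n + m = 0 := by exact_mod_cast this
      have h1 : n = 0 := by omega
      have h2 : m = 0 := by omega
      simp [hn, hm, h1, h2]
  | smul k x _ ih =>
    by_cases hk : k = 0
    · simp [hk]
    · refine Submodule.smul_mem _ _ (ih fun a ha haS => ?_)
      have := h a ha haS
      simpa [hk] using this

lemma sub_mem_of_coord (hφ : ∀ a ∈ π, φ a a = 1 ∧ ∀ b ∈ π, b ≠ a → φ a b = 0)
    {a x : V} (ha : a ∈ π) (hx : x ∈ Submodule.span ℕ π)
    (h : φ a x ≠ 0) : x - a ∈ Submodule.span ℕ π := by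
  induction hx using Submodule.span_induction with
  | mem x hx =>
    by_cases hxa : x = a
    · simp [hxa]
    · exact absurd ((hφ a ha).2 x hx hxa) h
  | zero => simp at h
  | add x y hx hy ihx ihy =>
    by_cases h1 : φ a x = 0
    · have : φ a y ≠ 0 := by simpa [h1] using h
      rw [add_sub_assoc]
      exact Submodule.add_mem _ hx (ihy this)
    · rw [add_sub_right_comm]
      exact Submodule.add_mem _ (ihx h1) hy
  | smul k x hx ih =>
    obtain _ | k := k
    · simp at h
    · have h1 : φ a x ≠ 0 := by
        intro h0; simp [h0] at h
      rw [add_smul, one_smul, add_sub_assoc]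
      exact Submodule.add_mem _ (Submodule.smul_mem _ _ hx) (ih h1)

lemma pointed (hφ : ∀ a ∈ π, φ a a = 1 ∧ ∀ b ∈ π, b ≠ a → φ a b = 0)
    {x : V} (hx : x ∈ Submodule.span ℕ π) (hx' : -x ∈ Submodule.span ℕ π) : x = 0 := by
  have : x ∈ Submodule.span ℕ (∅ : Set V) := by
    refine mem_of_coord hφ hx fun a ha _ => ?_
    obtain ⟨n, hn⟩ := coord_nat hφ ha hx
    obtain ⟨m, hm⟩ := coord_nat hφ ha hx'
    rw [map_neg, hn, neg_eq_iff_add_eq_zero] at hm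
    have : n + m = 0 := by exact_mod_cast hm
    have h1 : n = 0 := by omega
    simp [hn, h1]
  simpa using this

end comb

section lie

variable {K g : Type*} [Field K] [IsAlgClosed K] [CharZero K]
    [LieRing g] [LieAlgebra K g] [FiniteDimensional K g] [IsKilling K g]
    (H : LieSubalgebra K g) [H.IsCartanSubalgebra]

lemma exists_lie_ne_zero (α β : Weight K H g) (hα : α.IsNonZero) (hβ : β.IsNonZero)
    (hαβ : rootSpace H ((α : H → K) + β) ≠ ⊥) {e : g} (he : e ∈ rootSpace H β) (he0 : e ≠ 0) :
    ∃ x ∈ rootSpace H α, ⁅x, e⁆ ≠ 0 := by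
  obtain ⟨v, hv, v_ne0⟩ := (chainTop α β).exists_ne_zero
  obtain ⟨h, x, f, isSl2, hx, hf⟩ := exists_isSl2Triple_of_weight_isNonZero hα
  obtain rfl := isSl2.h_eq_coroot hα hx hf
  have prim : isSl2.HasPrimitiveVectorWith v (chainLength α β : K) :=
    have := lie_mem_genWeightSpace_of_mem_genWeightSpace hx hv
    ⟨v_ne0, (chainLength_smul _ _ hv).symm, by rwa [genWeightSpace_add_chainTop _ _ hα] at this⟩
  refine ⟨x, hx, ?_⟩
  have h1 := (rootSpace_zsmul_add_ne_bot_iff α β hα 1).1 (by simpa using hαβ)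
  obtain ⟨q, hq⟩ : ∃ q : ℕ, chainTopCoeff α β = q + 1 := ⟨chainTopCoeff α β - 1, by omega⟩
  have hlen := chainTopCoeff_le_chainLength α β
  have hmem := toEnd_pow_apply_mem hf hv (q + 1)
  have hw : ((q + 1) • (-(α : H → K)) + chainTop α β : H → K) = β := by
    rw [coe_chainTop', hq]; simp
  rw [hw] at hmem
  have hne := prim.pow_toEnd_f_ne_zero_of_eq_nat rfl (i := q + 1) (by omega)
  have hne' := prim.pow_toEnd_f_ne_zero_of_eq_nat rfl (i := q) (by omega)
  obtain ⟨k, hk⟩ : ∃ k : K, k • e = (toEnd K g g f ^ (q + 1)) v := by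
    simpa using (finrank_eq_one_iff_of_nonzero' ⟨e, he⟩ (by simpa using he0)).mp
      (finrank_rootSpace_eq_one _ hβ) ⟨_, hmem⟩
  intro h0
  have := prim.lie_e_pow_succ_toEnd_f q
  rw [← hk, lie_smul, h0, smul_zero, eq_comm, smul_eq_zero] at this
  rcases this with h | h
  · rcases mul_eq_zero.1 h with h | h
    · exact Nat.cast_add_one_ne_zero q h
    · rw [sub_eq_zero] at h
      have : chainLength α β = q := by exact_mod_cast h
      omega
  · exact hne' h

lemma mem_rootSp_iff (β : Module.Dual K H.toSubmodule) (x : g) :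
    x ∈ rootSp H.toSubmodule β ↔ x ∈ rootSpace H (fun h : H => β ⟨h.1, h.2⟩) := by
  constructor
  · intro h
    refine weightSpace_le_genWeightSpace g _ ?_
    rw [mem_weightSpace]
    intro y
    exact h ⟨y.1, y.2⟩
  · intro h y
    exact lie_eq_smul_of_mem_rootSpace h ⟨y.1, y.2⟩

/-- functional as a function on `H` -/
def fn (β : Module.Dual K H.toSubmodule) : H → K := fun h : H => β ⟨h.1, h.2⟩

lemma ne_bot_iff (β : Module.Dual K H.toSubmodule) :
    rootSp H.toSubmodule β ≠ ⊥ ↔ rootSpace H (fn H β) ≠ ⊥ := by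
  rw [Submodule.ne_bot_iff, ne_eq, LieSubmodule.eq_bot_iff]
  push Not
  simp only [mem_rootSp_iff]
  rfl

lemma exists_weight {β : Module.Dual K H.toSubmodule} (hβ : β ≠ 0)
    (h : rootSp H.toSubmodule β ≠ ⊥) :
    ∃ w : Weight K H g, (w : H → K) = fn H β ∧ w.IsNonZero := by
  rw [ne_bot_iff] at h
  refine ⟨⟨_, h⟩, rfl, ?_⟩
  intro h0
  apply hβ
  ext y
  exact congrFun h0 ⟨y.1, y.2⟩

/-- The set of roots. -/
def rts : Set (Module.Dual K H.toSubmodule) := {α | α ≠ 0 ∧ rootSp H.toSubmodule α ≠ ⊥}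

lemma lie_mem {a b : Module.Dual K H.toSubmodule} {x y : g} (hx : x ∈ rootSp H.toSubmodule a)
    (hy : y ∈ rootSp H.toSubmodule b) : ⁅x, y⁆ ∈ rootSp H.toSubmodule (a + b) := by
  intro h
  rw [leibniz_lie, hx h, hy h, smul_lie, lie_smul, LinearMap.add_apply, add_smul]

lemma disj {a b : Module.Dual K H.toSubmodule} {x : g} (hx : x ∈ rootSp H.toSubmodule a)
    (hy : x ∈ rootSp H.toSubmodule b) (hab : a ≠ b) : x = 0 := by
  by_contra h0
  apply hab
  ext h
  have := (hx h).symm.trans (hy h)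
  exact smul_left_injective K h0 this

lemma eq_zero_of_notMem {a : Module.Dual K H.toSubmodule} {x : g}
    (hx : x ∈ rootSp H.toSubmodule a) (ha : a ∉ rts H) (ha0 : a ≠ 0) : x = 0 := by
  by_contra h0
  exact ha ⟨ha0, (Submodule.ne_bot_iff _).2 ⟨x, hx, h0⟩⟩

lemma mem_H {x : g} (hx : x ∈ rootSp H.toSubmodule 0) : x ∈ H.toSubmodule := by
  have h1 : x ∈ rootSpace H (0 : H → K) := (mem_rootSp_iff H 0 x).1 hx
  have : x ∈ zeroRootSubalgebra K g H := h1
  rwa [zeroRootSubalgebra_eq_of_is_cartan] at this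

lemma H_mem {x : g} (hx : x ∈ H.toSubmodule) : x ∈ rootSp H.toSubmodule 0 := by
  intro y
  have := trivial_lie_zero H H ⟨y.1, y.2⟩ ⟨x, hx⟩
  have := congrArg Subtype.val this
  simpa using this

lemma neg_mem {a : Module.Dual K H.toSubmodule} (ha : a ∈ rts H) : -a ∈ rts H := by
  obtain ⟨w, hw, hw0⟩ := exists_weight H ha.1 ha.2
  refine ⟨neg_ne_zero.2 ha.1, ?_⟩
  rw [ne_bot_iff]
  have : fn H (-a) = ((-w : Weight K H g) : H → K) := by
    rw [Weight.coe_neg, hw]; rfl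
  rw [this]
  exact (-w).genWeightSpace_ne_bot

lemma pair {b : Module.Dual K H.toSubmodule} (hb : b ∈ rts H) :
    ∃ (h : H.toSubmodule), b h = 2 ∧ ∀ a ∈ rts H, ∃ n : ℤ, a h = n ∧
      (0 < n → a = b ∨ a - b ∈ rts H) ∧ (n < 0 → a = -b ∨ a + b ∈ rts H) ∧
      (n = 0 → (a + b ∈ rts H ↔ a - b ∈ rts H)) := by
  obtain ⟨w, hw, hw0⟩ := exists_weight H hb.1 hb.2
  have h2 := root_apply_coroot hw0
  rw [hw] at h2
  refine ⟨⟨(coroot w : H).1, (coroot w : H).2⟩, h2, ?_⟩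
  intro a ha
  obtain ⟨v, hv, hv0⟩ := exists_weight H ha.1 ha.2
  have h3 := apply_coroot_eq_cast w v
  rw [hv] at h3
  refine ⟨_, h3, ?_⟩
  have hp := rootSpace_zsmul_add_ne_bot_iff w v hw0 1
  have hm := rootSpace_zsmul_add_ne_bot_iff w v hw0 (-1)
  have ep : ((1 : ℤ) • (w : H → K) + v) = fn H (a + b) := by
    rw [hw, hv, one_smul, add_comm]; rfl
  have em : ((-1 : ℤ) • (w : H → K) + v) = fn H (a - b) := by
    rw [hw, hv, neg_smul, one_smul, add_comm, ← sub_eq_add_neg]; rfl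
  rw [ep, ← ne_bot_iff] at hp
  rw [em, ← ne_bot_iff] at hm
  have hap : rootSp H.toSubmodule (a + b) ≠ ⊥ → a = -b ∨ a + b ∈ rts H := fun h => by
    by_cases h0 : a + b = 0
    · exact Or.inl (eq_neg_of_add_eq_zero_left h0)
    · exact Or.inr ⟨h0, h⟩
  have ham : rootSp H.toSubmodule (a - b) ≠ ⊥ → a = b ∨ a - b ∈ rts H := fun h => by
    by_cases h0 : a - b = 0
    · exact Or.inl (sub_eq_zero.1 h0)
    · exact Or.inr ⟨h0, h⟩
  refine ⟨fun hn => ham (hm.2 (by omega)), fun hn => hap (hp.2 (by omega)), fun hn => ?_⟩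
  have h30 : a ⟨(coroot w : H).1, (coroot w : H).2⟩ = 0 := by
    have : fn H a (coroot w) = 0 := by rw [h3, hn]; simp
    exact this
  have h22 : b ⟨(coroot w : H).1, (coroot w : H).2⟩ = 2 := h2
  have e : rootSp H.toSubmodule (a + b) ≠ ⊥ ↔ rootSp H.toSubmodule (a - b) ≠ ⊥ := by
    rw [hp, hm]; omega
  have n1 : a + b ≠ 0 := fun h => by
    have := LinearMap.congr_fun h ⟨(coroot w : H).1, (coroot w : H).2⟩
    rw [LinearMap.add_apply, h30, h22] at this
    simp at this
  have n2 : a - b ≠ 0 := fun h => by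
    have := LinearMap.congr_fun h ⟨(coroot w : H).1, (coroot w : H).2⟩
    rw [LinearMap.sub_apply, h30, h22] at this
    simp at this
  exact ⟨fun h => ⟨n2, e.1 h.2⟩, fun h => ⟨n1, e.2 h.2⟩⟩

lemma lie_ne {a b : Module.Dual K H.toSubmodule} (ha : a ∈ rts H) (hb : b ∈ rts H)
    (hab : a + b ∈ rts H ∨ a + b = 0) {e : g} (he : e ∈ rootSp H.toSubmodule b) (he0 : e ≠ 0) :
    ∃ x ∈ rootSp H.toSubmodule a, ⁅x, e⁆ ≠ 0 := by
  obtain ⟨w, hw, hw0⟩ := exists_weight H ha.1 ha.2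
  obtain ⟨v, hv, hv0⟩ := exists_weight H hb.1 hb.2
  have key : rootSpace H ((w : H → K) + v) ≠ ⊥ := by
    have e1 : ((w : H → K) + v) = fn H (a + b) := by rw [hw, hv]; rfl
    rw [e1]
    rcases hab with h | h
    · exact (ne_bot_iff H _).1 h.2
    · rw [h]
      have : Nontrivial g := ⟨e, 0, he0⟩
      exact (0 : Weight K H g).genWeightSpace_ne_bot
  obtain ⟨x, hx, hx0⟩ := exists_lie_ne_zero H w v hw0 hv0 key (e := e)
    (by rw [hv]; exact (mem_rootSp_iff H _ _).1 he) he0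
  exact ⟨x, (mem_rootSp_iff H _ _).2 (by rw [hw] at hx; exact hx), hx0⟩

lemma comb_top {π : Set (Module.Dual K H.toSubmodule)} (hπ : π ⊆ rts H)
    {θ β : Module.Dual K H.toSubmodule} (hθ : θ ∈ rts H) (hβ : β ∈ rts H)
    (hle : θ - β ∈ Submodule.span ℕ π)
    (h : ∀ γ ∈ rts H, γ ∈ Submodule.span ℕ π → γ + β ∉ rts H ∧ γ + β ≠ 0) : β = θ := by
  obtain ⟨t, ht2, ht⟩ := pair H hβ
  obtain ⟨m, hm⟩ := nn_nat (LinearMap.applyₗ (R := K) t) (x := θ - β) (S := π) (by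
    intro a ha
    obtain ⟨n, hn, -, h2, -⟩ := ht a (hπ ha)
    obtain ⟨h3, h4⟩ := h a (hπ ha) (Submodule.subset_span ha)
    have : 0 ≤ n := by
      by_contra hneg
      rcases h2 (by omega) with h5 | h5
      · exact h4 (by rw [h5]; simp)
      · exact h3 h5
    lift n to ℕ using this
    exact ⟨n, by simpa using hn⟩) hle
  obtain ⟨n, hn, h1, -, -⟩ := ht θ hθ
  simp only [LinearMap.applyₗ_apply_apply, LinearMap.sub_apply, hn, ht2] at hm
  have : n - 2 = m := by exact_mod_cast hm
  rcases h1 (by omega) with h5 | h5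
  · exact h5.symm
  · exact absurd (by simpa using hθ) (h _ h5 hle).1

lemma comb_simple {π : Set (Module.Dual K H.toSubmodule)} (hπ : π ⊆ rts H)
    {φ : Module.Dual K H.toSubmodule → (Module.Dual K H.toSubmodule →ₗ[K] K)}
    (hφ : ∀ a ∈ π, φ a a = 1 ∧ ∀ b ∈ π, b ≠ a → φ a b = 0)
    {δ : Module.Dual K H.toSubmodule} (hδ : δ ∈ rts H) (hδπ : δ ∈ Submodule.span ℕ π) :
    δ ∈ π ∨ ∃ a ∈ π, δ - a ∈ rts H ∧ δ - a ∈ Submodule.span ℕ π := by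
  obtain ⟨t, ht2, ht⟩ := pair H hδ
  by_contra hcon
  push Not at hcon
  obtain ⟨hc1, hc2⟩ := hcon
  have hS : δ ∈ Submodule.span ℕ {a ∈ π | φ a δ ≠ 0} := by
    refine mem_of_coord hφ hδπ fun a ha haS => ?_
    by_contra h0
    exact haS ⟨ha, h0⟩
  obtain ⟨m, hm⟩ := nn_nat (-LinearMap.applyₗ (R := K) t) (by
    rintro a ⟨ha, ha0⟩
    obtain ⟨n, hn, h1, -, -⟩ := ht a (hπ ha)
    have : 0 ≤ -n := by
      by_contra hpos
      rcases h1 (by omega) with h5 | h5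
      · exact hc1 (h5 ▸ ha)
      · exact hc2 a ha (by simpa using neg_mem H h5) (sub_mem_of_coord hφ ha hδπ ha0)
    obtain ⟨k, hk⟩ := Int.eq_ofNat_of_zero_le this
    refine ⟨k, ?_⟩
    have : n = -k := by omega
    simp [hn, this]) hS
  simp only [LinearMap.neg_apply, LinearMap.applyₗ_apply_apply, ht2] at hm
  have : (-2 : ℤ) = m := by exact_mod_cast hm
  omega

lemma comb_orth {S : Set (Module.Dual K H.toSubmodule)} (hS : S ⊆ rts H)
    {δ γ : Module.Dual K H.toSubmodule} (hδ : δ ∈ rts H) (hγ : γ ∈ rts H)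
    (hγS : γ ∈ Submodule.span ℕ S)
    (h : ∀ a ∈ S, a - δ ∉ rts H ∧ a + δ ∉ rts H ∧ a ≠ δ ∧ a ≠ -δ) :
    (γ + δ ∈ rts H ↔ γ - δ ∈ rts H) ∧ γ ≠ δ := by
  obtain ⟨t, ht2, ht⟩ := pair H hδ
  have h0 := nn_eq_zero (LinearMap.applyₗ (R := K) t) (by
    intro a ha
    obtain ⟨n, hn, h1, h2, -⟩ := ht a (hS ha)
    obtain ⟨g1, g2, g3, g4⟩ := h a ha
    have : n = 0 := by
      by_contra hne
      rcases lt_or_gt_of_ne hne with h5 | h5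
      · rcases h2 h5 with h | h <;> contradiction
      · rcases h1 h5 with h | h <;> contradiction
    simp [hn, this]) hγS
  rw [LinearMap.applyₗ_apply_apply] at h0
  obtain ⟨n, hn, -, -, h3⟩ := ht γ hγ
  refine ⟨h3 ?_, ?_⟩
  · rw [h0] at hn
    exact_mod_cast hn.symm
  · rintro rfl
    rw [ht2] at h0
    simp at h0

end lie
end PC

/-- in the parabolic contraction `q = p ⋉ (n⁻)ᵃ` of a simple Lie algebra
`g` (with Cartan subalgebra `H`, root system `R`, base `π`, subset `π' ⊊ π` and highest
root `θ`), a nonzero `e ∈ q` is a degree-one semi-invariant of `Sym(q)`, i.e.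
`[x, e]_q ∈ C·e` for all `x`, if and only if `e ∈ g_β` for some
`β ∈ (−π \ −π') ∪ {θ}` such that the node of `−β` in the extended Dynkin diagram is not
linked to any node of `π'` (i.e. `−β + α' ∉ R` for all `α' ∈ π'`). -/
theorem degree_one_semiinvariants_of_parabolic_contraction
    {K g : Type*} [Field K] [IsAlgClosed K] [CharZero K]
    [LieRing g] [LieAlgebra K g] [FiniteDimensional K g] [LieAlgebra.IsSimple K g]
    (H : LieSubalgebra K g) [H.IsCartanSubalgebra]
    (R : Set (Module.Dual K H.toSubmodule))
    (hR : R = {α | α ≠ 0 ∧ rootSp H.toSubmodule α ≠ ⊥})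
    (π π' : Set (Module.Dual K H.toSubmodule))
    (hπR : π ⊆ R) (hπ'π : π' ⊆ π) (hπ'ne : π' ≠ π)
    (hπind : LinearIndependent K fun a : π => (a : Module.Dual K H.toSubmodule))
    (hbase : ∀ α ∈ R, isNNComb H.toSubmodule π α ∨ isNNComb H.toSubmodule π (-α))
    (θ : Module.Dual K H.toSubmodule) (hθR : θ ∈ R)
    (hθhigh : ∀ α ∈ R, ∃ c : Module.Dual K H.toSubmodule →₀ ℕ,
      ↑c.support ⊆ π ∧ θ = α + c.sum fun γ k => k • γ)
    (P N : Submodule K g)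
    (hPdef : P = H.toSubmodule ⊔
      ⨆ α ∈ {α ∈ R | isNNComb H.toSubmodule π α ∨ isNNComb H.toSubmodule π' (-α)},
        rootSp H.toSubmodule α)
    (hNdef : N = ⨆ α ∈ {α ∈ R |
        ¬(isNNComb H.toSubmodule π α ∨ isNNComb H.toSubmodule π' (-α))},
      rootSp H.toSubmodule α)
    (hcompl : IsCompl P N)
    (pP pN : g →ₗ[K] g)
    (hpP : pP = P.subtype ∘ₗ Submodule.linearProjOfIsCompl P N hcompl)
    (hpN : pN = N.subtype ∘ₗ Submodule.linearProjOfIsCompl N P hcompl.symm)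
    (br : g → g → g)
    (hbr : ∀ x y, br x y = ⁅pP x, pP y⁆ + pN ⁅pP x, pN y⁆ - pN ⁅pP y, pN x⁆)
    (e : g) (he : e ≠ 0) :
    (∀ x : g, ∃ c : K, br x e = c • e) ↔
      ∃ β : Module.Dual K H.toSubmodule,
        ((-β ∈ π ∧ -β ∉ π') ∨ β = θ) ∧
        e ∈ rootSp H.toSubmodule β ∧
        ∀ α' ∈ π', -β + α' ∉ R := by
  have hK : LieAlgebra.IsKilling K g := inferInstance
  replace hR : R = PC.rts H := hR
  subst hR
  have nn : ∀ S (x : Module.Dual K H.toSubmodule),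
      isNNComb H.toSubmodule S x ↔ x ∈ Submodule.span ℕ S := by
    intro S x
    rw [Submodule.mem_span_set]
    exact ⟨fun ⟨c, h1, h2⟩ => ⟨c, h1, h2.symm⟩, fun ⟨c, h1, h2⟩ => ⟨c, h1, h2.symm⟩⟩
  have hθle : ∀ α ∈ PC.rts H, θ - α ∈ Submodule.span ℕ π := by
    intro α hα
    obtain ⟨c, h1, h2⟩ := hθhigh α hα
    exact (nn _ _).1 ⟨c, h1, by rw [h2]; simp⟩
  simp only [nn] at hbase hPdef hNdef
  obtain ⟨φ, hφ⟩ := PC.exists_coord hπind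
  have hmono : ∀ x, x ∈ Submodule.span ℕ π' → x ∈ Submodule.span ℕ π :=
    fun x hx => Submodule.span_mono hπ'π hx
  -- projections
  have pP1 : ∀ x ∈ P, pP x = x := by
    intro x hx
    rw [hpP]
    exact congrArg Subtype.val (Submodule.linearProjOfIsCompl_apply_left hcompl ⟨x, hx⟩)
  have pP0 : ∀ x ∈ N, pP x = 0 := by
    intro x hx
    rw [hpP]
    exact congrArg Subtype.val (Submodule.linearProjOfIsCompl_apply_right hcompl ⟨x, hx⟩)
  have pN1 : ∀ x ∈ N, pN x = x := by
    intro x hx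
    rw [hpN]
    exact congrArg Subtype.val (Submodule.linearProjOfIsCompl_apply_left hcompl.symm ⟨x, hx⟩)
  have pN0 : ∀ x ∈ P, pN x = 0 := by
    intro x hx
    rw [hpN]
    exact congrArg Subtype.val (Submodule.linearProjOfIsCompl_apply_right hcompl.symm ⟨x, hx⟩)
  have HP : H.toSubmodule ≤ P := by rw [hPdef]; exact le_sup_left
  have RP : ∀ α ∈ PC.rts H, (α ∈ Submodule.span ℕ π ∨ -α ∈ Submodule.span ℕ π') →
      rootSp H.toSubmodule α ≤ P := by
    intro α h1 h2
    rw [hPdef]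
    exact le_sup_of_le_right (le_iSup₂_of_le α ⟨h1, h2⟩ le_rfl)
  have RN : ∀ α ∈ PC.rts H, ¬ (α ∈ Submodule.span ℕ π ∨ -α ∈ Submodule.span ℕ π') →
      rootSp H.toSubmodule α ≤ N := by
    intro α h1 h2
    rw [hNdef]
    exact le_iSup₂_of_le α ⟨h1, h2⟩ le_rfl
  have RP' : ∀ α, (α ∈ PC.rts H → (α ∈ Submodule.span ℕ π ∨ -α ∈ Submodule.span ℕ π')) →
      rootSp H.toSubmodule α ≤ P := by
    intro α h
    by_cases h1 : α ∈ PC.rts H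
    · exact RP α h1 (h h1)
    · by_cases h0 : α = 0
      · subst h0
        exact fun x hx => HP (PC.mem_H H hx)
      · intro x hx
        rw [PC.eq_zero_of_notMem H hx h1 h0]
        exact zero_mem _
  have brPP : ∀ x ∈ P, e ∈ P → br x e = ⁅x, e⁆ := by
    intro x hx he
    rw [hbr, pP1 x hx, pP1 e he, pN0 x hx, pN0 e he]; simp
  have brNP : ∀ x ∈ N, e ∈ P → br x e = - pN ⁅e, x⁆ := by
    intro x hx he
    rw [hbr, pP0 x hx, pP1 e he, pN1 x hx, pN0 e he]; simp
  have brPN : ∀ x ∈ P, e ∈ N → br x e = pN ⁅x, e⁆ := by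
    intro x hx he
    rw [hbr, pP1 x hx, pP0 e he, pN0 x hx, pN1 e he]; simp
  have brNN : ∀ x ∈ N, e ∈ N → br x e = 0 := by
    intro x hx he
    rw [hbr, pP0 x hx, pP0 e he]; simp
  have smul_mem' : ∀ (c : K) (β : Module.Dual K H.toSubmodule), e ∈ rootSp H.toSubmodule β →
      c • e ∈ rootSp H.toSubmodule β := fun c β h => Submodule.smul_mem _ c h
  constructor
  · intro hs
    -- `e` is a weight vector
    have hdec : ∀ y ∈ H.toSubmodule, br y e = ⁅y, e⁆ := by
      intro y hy
      have hsum : e ∈ P ⊔ N := by rw [hcompl.sup_eq_top]; trivial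
      obtain ⟨u, hu, v, hv, rfl⟩ := Submodule.mem_sup.1 hsum
      have hyv : ⁅y, v⁆ ∈ N := by
        have hle : N ≤ N.comap (LieAlgebra.ad K g y) := by
          conv_lhs => rw [hNdef]
          refine iSup₂_le fun α hα x hx => ?_
          have h1 : ⁅y, x⁆ = α ⟨y, hy⟩ • x := hx ⟨y, hy⟩
          have h2 : ⁅y, x⁆ ∈ N := by
            rw [h1]; exact N.smul_mem _ (RN α hα.1 hα.2 hx)
          simpa using h2
        simpa using hle hv
      rw [hbr, map_add, map_add, pP1 y (HP hy), pN0 y (HP hy), pP1 u hu, pP0 v hv, pN0 u hu,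
        pN1 v hv]
      simp [pN1 _ hyv]
    have hsH : ∀ y : H.toSubmodule, ∃ c : K, ⁅(y : g), e⁆ = c • e := by
      intro y
      obtain ⟨c, hc⟩ := hs y
      exact ⟨c, by rw [← hdec y y.2, hc]⟩
    choose f hf using hsH
    have hinj := smul_left_injective K he
    let β : Module.Dual K H.toSubmodule :=
      { toFun := f
        map_add' := fun a b => hinj (by
          simp only [← hf, add_smul, Submodule.coe_add, add_lie])
        map_smul' := fun c a => hinj (by
          simp only [← hf, smul_eq_mul, mul_smul, Submodule.coe_smul, smul_lie, RingHom.id_apply]) }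
    have heβ : e ∈ rootSp H.toSubmodule β := hf
    clear_value β
    -- a bracket vanishes as soon as it is proportional to `e`
    have van : ∀ γ : Module.Dual K H.toSubmodule, γ ≠ 0 → ∀ x ∈ rootSp H.toSubmodule γ,
        br x e = ⁅x, e⁆ → ⁅x, e⁆ = 0 := by
      intro γ hγ x hx h
      obtain ⟨c, hc⟩ := hs x
      refine PC.disj H (PC.lie_mem H hx heβ) (b := β) ?_ (by simpa using hγ)
      rw [← h, hc]
      exact smul_mem' c β heβ
    by_cases hβ0 : β = 0
    · exfalso
      subst hβ0
      have heH := PC.mem_H H heβ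
      have heP := HP heH
      have hz : ∀ γ ∈ PC.rts H, ∀ x ∈ rootSp H.toSubmodule γ, ⁅x, e⁆ = 0 := by
        intro γ hγ x hx
        refine van γ hγ.1 x hx ?_
        by_cases ht : γ ∈ Submodule.span ℕ π ∨ -γ ∈ Submodule.span ℕ π'
        · exact brPP x (RP γ hγ ht hx) heP
        · rw [brNP x (RN γ hγ ht hx) heP, pN1, lie_skew]
          have : ⁅e, x⁆ = γ ⟨e, heH⟩ • x := hx ⟨e, heH⟩
          rw [this]
          exact N.smul_mem _ (RN γ hγ ht hx)
      have hker : P ⊔ N ≤ LinearMap.ker (LieAlgebra.ad K g e) := by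
        have hz' : ∀ γ ∈ PC.rts H, rootSp H.toSubmodule γ ≤
            LinearMap.ker (LieAlgebra.ad K g e) := by
          intro γ hγ x hx
          have := hz γ hγ x hx
          rw [← lie_skew, neg_eq_zero] at this
          simpa using this
        rw [hPdef, hNdef]
        refine sup_le (sup_le ?_ (iSup₂_le fun γ hγ => hz' γ hγ.1)) (iSup₂_le fun γ hγ => hz' γ hγ.1)
        intro x hx
        have h0 : ⁅x, e⁆ = 0 := by simpa using heβ ⟨x, hx⟩
        have h1 : ⁅e, x⁆ = 0 := by rw [← lie_skew, h0, neg_zero]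
        simpa using h1
      rw [hcompl.sup_eq_top] at hker
      have hc : e ∈ LieAlgebra.center K g := by
        rw [LieModule.mem_maxTrivSubmodule]
        intro x
        have : ⁅e, x⁆ = 0 := by simpa using hker (Submodule.mem_top (x := x))
        rw [← lie_skew, this, neg_zero]
      rw [LieAlgebra.center_eq_bot] at hc
      exact he (by simpa using hc)
    have hβ : β ∈ PC.rts H := by
      by_contra h
      exact he (PC.eq_zero_of_notMem H heβ h hβ0)
    by_cases hT : β ∈ Submodule.span ℕ π ∨ -β ∈ Submodule.span ℕ π'
    · have heP := RP β hβ hT heβ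
      have hno : ∀ γ ∈ PC.rts H, (γ ∈ Submodule.span ℕ π ∨ -γ ∈ Submodule.span ℕ π') →
          γ + β ∉ PC.rts H ∧ γ + β ≠ 0 := by
        intro γ hγ hγT
        rw [← not_or]
        intro hor
        obtain ⟨x, hx, hx0⟩ := PC.lie_ne H hγ hβ hor heβ he
        exact hx0 (van γ hγ.1 x hx (brPP x (RP γ hγ hγT hx) heP))
      have hβθ : β = θ := PC.comb_top H hπR hθR hβ (hθle β hβ) fun γ h1 h2 => hno γ h1 (Or.inl h2)
      refine ⟨β, Or.inr hβθ, heβ, ?_⟩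
      intro α' hα' hmem
      have h1 := hno (-α') (PC.neg_mem H (hπR (hπ'π hα')))
        (Or.inr (by rw [neg_neg]; exact Submodule.subset_span hα'))
      have h2 := PC.neg_mem H hmem
      refine h1.1 ?_
      convert h2 using 1
      abel
    · have heN := RN β hβ hT heβ
      have hno : ∀ γ ∈ PC.rts H, (γ ∈ Submodule.span ℕ π ∨ -γ ∈ Submodule.span ℕ π') →
          γ + β ∈ PC.rts H →
          (γ + β ∈ Submodule.span ℕ π ∨ -(γ + β) ∈ Submodule.span ℕ π') := by
        intro γ hγ hγT hor
        by_contra hnT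
        obtain ⟨x, hx, hx0⟩ := PC.lie_ne H hγ hβ (Or.inl hor) heβ he
        refine hx0 (van γ hγ.1 x hx ?_)
        rw [brPN x (RP γ hγ hγT hx) heN, pN1]
        exact RN _ hor hnT (PC.lie_mem H hx heβ)
      rw [not_or] at hT
      have hδ : -β ∈ Submodule.span ℕ π := (hbase β hβ).resolve_left hT.1
      have hδR := PC.neg_mem H hβ
      have hsimple : -β ∈ π := by
        rcases PC.comb_simple H hπR hφ hδR hδ with h | ⟨a, ha, h1, h2⟩
        · exact h
        · exfalso
          have e1 : a + β = -(-β - a) := by abel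
          have h3 : a + β ∈ PC.rts H := by rw [e1]; exact PC.neg_mem H h1
          have h4 := hno a (hπR ha) (Or.inl (Submodule.subset_span ha)) h3
          have h5 : -(a + β) ∈ Submodule.span ℕ π' := by
            refine h4.resolve_left fun h => ?_
            refine h3.1 (PC.pointed hφ h ?_)
            rw [e1, neg_neg]; exact h2
          have e2 : -β - a = -(a + β) := by abel
          have e3 : (-β - a) + β = -a := by abel
          have h6 := hno (-β - a) h1 (Or.inl h2) (by rw [e3]; exact PC.neg_mem H (hπR ha))
          rw [e3, neg_neg] at h6
          have h7 : a ∈ Submodule.span ℕ π' := h6.resolve_left fun h =>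
            (hπR ha).1 (PC.pointed hφ (Submodule.subset_span ha) h)
          refine hT.2 ?_
          have e4 : -β = a + -(a + β) := by abel
          rw [e4]
          exact Submodule.add_mem _ h7 h5
      have hn' : -β ∉ π' := fun h => hT.2 (Submodule.subset_span h)
      refine ⟨β, Or.inl ⟨hsimple, hn'⟩, heβ, ?_⟩
      intro α' hα' hmem
      have e1 : -α' + β = -(-β + α') := by abel
      have h1 := hno (-α') (PC.neg_mem H (hπR (hπ'π hα')))
        (Or.inr (by rw [neg_neg]; exact Submodule.subset_span hα'))
        (by rw [e1]; exact PC.neg_mem H hmem)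
      rw [e1, neg_neg] at h1
      have hpos : -β + α' ∈ Submodule.span ℕ π :=
        Submodule.add_mem _ hδ (Submodule.subset_span (hπ'π hα'))
      rcases h1 with h1 | h1
      · exact hmem.1 (PC.pointed hφ hpos h1)
      · have h2 := PC.coord_zero hφ hπ'π hsimple hn' h1
        rw [map_add, (hφ _ hsimple).1,
          (hφ _ hsimple).2 α' (hπ'π hα') (by rintro h; exact hn' (h ▸ hα'))] at h2
        simp at h2
  · rintro ⟨β, hβcase, heβ, hadj⟩
    -- it suffices to check on generators
    let T : g →ₗ[K] g :=
      { toFun := fun x => br x e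
        map_add' := fun x y => by
          simp only [hbr, map_add, add_lie, lie_add]; abel
        map_smul' := fun c x => by
          simp only [hbr, map_smul, smul_lie, lie_smul, RingHom.id_apply, smul_add, smul_sub] }
    have hT : ∀ x, T x = br x e := fun x => rfl
    suffices hle : P ⊔ N ≤ (Submodule.span K {e}).comap T by
      intro x
      rw [hcompl.sup_eq_top] at hle
      obtain ⟨c, hc⟩ := Submodule.mem_span_singleton.1 (hle (Submodule.mem_top (x := x)))
      exact ⟨c, by rw [← hT, hc]⟩
    have zmem : ∀ x, br x e = 0 → x ∈ (Submodule.span K {e}).comap T := by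
      intro x hx
      rw [Submodule.mem_comap, hT, hx]; exact zero_mem _
    rcases hβcase with ⟨hβπ, hβπ'⟩ | rfl
    · have hδR := hπR hβπ
      have hβ : β ∈ PC.rts H := by simpa using PC.neg_mem H hδR
      have hδ : -β ∈ Submodule.span ℕ π := Submodule.subset_span hβπ
      have hnT : ¬ (β ∈ Submodule.span ℕ π ∨ -β ∈ Submodule.span ℕ π') := by
        rintro (h | h)
        · exact hβ.1 (PC.pointed hφ h hδ)
        · have := PC.coord_zero hφ hπ'π hβπ hβπ' h
          rw [(hφ _ hβπ).1] at this
          simp at this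
      have heN := RN β hβ hnT heβ
      refine sup_le ?_ fun x hx => zmem x (brNN x hx heN)
      conv_lhs => rw [hPdef]
      refine sup_le ?_ (iSup₂_le fun γ hγ x hx => zmem x ?_)
      · intro y hy
        have : ⁅y, e⁆ = β ⟨y, hy⟩ • e := heβ ⟨y, hy⟩
        rw [Submodule.mem_comap, hT, brPN y (HP hy) heN, this, pN1 _ (N.smul_mem _ heN)]
        exact Submodule.smul_mem _ _ (Submodule.mem_span_singleton_self e)
      · obtain ⟨hγR, hγT⟩ := hγ
        rw [brPN x (RP γ hγR hγT hx) heN]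
        refine pN0 _ (RP' (γ + β) (fun hR' => ?_) (PC.lie_mem H hx heβ))
        rcases hγT with hγp | hγn
        · rcases hbase _ hR' with h | h
          · exact Or.inl h
          · exfalso
            -- `-β = γ + (-(γ+β))` is simple
            have hc : ∀ a ∈ π, a ≠ -β → φ a γ = 0 ∧ φ a (-(γ + β)) = 0 := by
              intro a ha hab
              obtain ⟨n, hn⟩ := PC.coord_nat hφ ha hγp
              obtain ⟨m, hm⟩ := PC.coord_nat hφ ha h
              have h0 := (hφ a ha).2 (-β) hβπ (Ne.symm hab)
              have e1 : -β = γ + -(γ + β) := by abel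
              rw [e1, map_add, hn, hm] at h0
              have : n + m = 0 := by exact_mod_cast h0
              have h1 : n = 0 := by omega
              have h2 : m = 0 := by omega
              exact ⟨by rw [hn, h1]; simp, by rw [hm, h2]; simp⟩
            obtain ⟨n, hn⟩ := PC.coord_nat hφ hβπ hγp
            obtain ⟨m, hm⟩ := PC.coord_nat hφ hβπ h
            have h1 := (hφ _ hβπ).1
            have e1 : φ (-β) (-β) = φ (-β) γ + φ (-β) (-(γ + β)) := by
              rw [← map_add]; congr 1; abel
            rw [e1, hn, hm] at h1
            have h2 : n + m = 1 := by exact_mod_cast h1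
            have zero_of : ∀ z ∈ Submodule.span ℕ π, (∀ a ∈ π, φ a z = 0) → z = 0 := by
              intro z hz hall
              have : z ∈ Submodule.span ℕ (∅ : Set (Module.Dual K H.toSubmodule)) :=
                PC.mem_of_coord hφ hz fun a ha _ => hall a ha
              simpa using this
            rcases Nat.eq_zero_or_pos n with h3 | h3
            · refine hγR.1 (zero_of γ hγp fun a ha => ?_)
              by_cases hab : a = -β
              · rw [hab, hn, h3]; simp
              · exact (hc a ha hab).1
            · have h4 : m = 0 := by omega
              refine (PC.neg_mem H hR').1 (zero_of _ h fun a ha => ?_)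
              by_cases hab : a = -β
              · rw [hab, hm, h4]; simp
              · exact (hc a ha hab).2
        · exfalso
          -- orthogonality
          have mixed : ∀ z ∈ Submodule.span ℕ π', z ≠ 0 → z + β ∉ PC.rts H := by
            intro z hz hz0 hzR
            rcases hbase _ hzR with h | h
            · obtain ⟨n, hn⟩ := PC.coord_nat hφ hβπ h
              rw [map_add, PC.coord_zero hφ hπ'π hβπ hβπ' hz, zero_add, ← neg_neg β, neg_neg (-β),
                map_neg, (hφ _ hβπ).1] at hn
              have : (-1 : ℤ) = n := by exact_mod_cast hn
              omega
            · refine hz0 (PC.pointed hφ (hmono z hz) ?_)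
              have hS : -z ∈ Submodule.span ℕ π := by
                have := PC.sub_mem_of_coord hφ hβπ h (by
                  have e1 : -(z + β) = -z + -β := by abel
                  rw [e1, map_add, map_neg, PC.coord_zero hφ hπ'π hβπ hβπ' hz, (hφ _ hβπ).1]
                  simp)
                have e2 : -(z + β) - -β = -z := by abel
                rwa [e2] at this
              exact hS
          have ho := PC.comb_orth H (hπ'π.trans hπR) hδR (PC.neg_mem H hγR) hγn (by
            intro a ha
            refine ⟨?_, ?_, ?_, ?_⟩
            · rw [sub_neg_eq_add]
              exact mixed a (Submodule.subset_span ha) (hπR (hπ'π ha)).1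
            · rw [add_comm]; exact hadj a ha
            · rintro rfl; exact hβπ' ha
            · rw [neg_neg]
              rintro rfl
              exact hnT (Or.inl (Submodule.subset_span (hπ'π ha))))
          have h1 : -γ + -β ∈ PC.rts H := by
            have := PC.neg_mem H hR'
            convert this using 1
            abel
          have h2 := ho.1.1 h1
          rw [sub_neg_eq_add] at h2
          exact mixed _ hγn (PC.neg_mem H hγR).1 h2
    · have hθpos : β ∈ Submodule.span ℕ π := by
        rcases hbase β hθR with h | h
        · exact h
        · -- otherwise `-β` is positive and below `β`
          have h1 := hθle _ (PC.neg_mem H hθR)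
          rw [sub_neg_eq_add] at h1
          have h2 : β + β + -β ∈ Submodule.span ℕ π := Submodule.add_mem _ h1 h
          simpa using h2
      have heP := RP β hθR (Or.inl hθpos) heβ
      have hup : ∀ γ ∈ Submodule.span ℕ π, γ ≠ 0 → γ + β ∉ PC.rts H := by
        intro γ hγ hγ0 hR'
        have := hθle _ hR'
        have e1 : β - (γ + β) = -γ := by abel
        rw [e1] at this
        exact hγ0 (PC.pointed hφ hγ this)
      have hθπ' : β ∉ π' := by
        intro hmem
        -- then `π = {β}`
        obtain ⟨a, ha, ha'⟩ := Set.exists_of_ssubset (hπ'π.ssubset_of_ne hπ'ne)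
        have h1 := hθle a (hπR ha)
        obtain ⟨n, hn⟩ := PC.coord_nat hφ ha h1
        rw [map_sub, (hφ a ha).1, (hφ a ha).2 β (hπ'π hmem) (by rintro rfl; exact ha' hmem)] at hn
        have : (0 - 1 : ℤ) = n := by exact_mod_cast hn
        omega
      refine sup_le ?_ ?_
      · conv_lhs => rw [hPdef]
        refine sup_le ?_ (iSup₂_le fun γ hγ x hx => zmem x ?_)
        · intro y hy
          have : ⁅y, e⁆ = β ⟨y, hy⟩ • e := heβ ⟨y, hy⟩
          rw [Submodule.mem_comap, hT, brPP y (HP hy) heP, this]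
          exact Submodule.smul_mem _ _ (Submodule.mem_span_singleton_self e)
        · obtain ⟨hγR, hγT⟩ := hγ
          rw [brPP x (RP γ hγR hγT hx) heP]
          rcases hγT with hγp | hγn
          · refine PC.eq_zero_of_notMem H (PC.lie_mem H hx heβ) (hup γ hγp hγR.1) fun h0 => ?_
            have : -γ = β := (eq_neg_of_add_eq_zero_right h0).symm
            exact hγR.1 (PC.pointed hφ hγp (this ▸ hθpos))
          · have ho := PC.comb_orth H (hπ'π.trans hπR) hθR (PC.neg_mem H hγR) hγn (by
              intro a ha
              refine ⟨?_, ?_, ?_, ?_⟩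
              · rw [sub_eq_neg_add]; exact hadj a ha
              · exact hup a (Submodule.subset_span (hπ'π ha)) (hπR (hπ'π ha)).1
              · rintro rfl; exact hθπ' ha
              · rintro rfl
                exact hθR.1 (PC.pointed hφ hθpos (Submodule.subset_span (hπ'π ha))))
            refine PC.eq_zero_of_notMem H (PC.lie_mem H hx heβ) ?_ ?_
            · intro hR'
              refine hup (-γ) (hmono _ hγn) (PC.neg_mem H hγR).1 (ho.1.2 ?_)
              have := PC.neg_mem H hR'
              convert this using 1
              abel
            · intro h0
              exact ho.2 (eq_neg_of_add_eq_zero_right h0).symm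
      · conv_lhs => rw [hNdef]
        refine iSup₂_le fun γ hγ x hx => zmem x ?_
        rw [brNP x (RN γ hγ.1 hγ.2 hx) heP, neg_eq_zero]
        refine pN0 _ (RP' (β + γ) (fun hR' => Or.inl ?_) (PC.lie_mem H heβ hx))
        have := hθle _ (PC.neg_mem H hγ.1)
        rwa [sub_neg_eq_add] at this
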